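/- arXiv:1401.3086 — 2 statements merged into one kernel-verified Lean document; each statement's English description precedes it below -/
import Mathlib

section
/- Let W be an irreducible 𝔽₂L-module on which L acts nontrivially and let t ∈ O₃(L). Then either t acts trivially on W ([t,W] = 1) or t acts fixed-point-freely on W (the only vector of W fixed by t is 0). -/
open MulAction Pointwise

/-- `V`, the `n`-dimensional vector space over the field with 3 elements. -/
abbrev Vec (n : ℕ) := Fin n → ZMod 3

/-- The translation subgroup `V` of `Perm (Vec n)`. -/
def TransGrp (n : ℕ) : Subgroup (Equiv.Perm (Vec n)) :=
  Subgroup.closure {f : Equiv.Perm (Vec n) | ∃ w, ∀ v, f v = v + w}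

/-- The Frobenius group `L = V ⋊ C₂` of order `2·3^n`, acting on `V = Vec n`
by `v ↦ ε·v + w` with `ε = ±1`: it is generated by the translations and negation. -/
def Lgrp (n : ℕ) : Subgroup (Equiv.Perm (Vec n)) :=
  Subgroup.closure ({f : Equiv.Perm (Vec n) | ∃ w, ∀ v, f v = v + w} ∪ {Equiv.neg (Vec n)})

/-- Every element of `TransGrp n` is a translation. -/
theorem exists_add_of_mem_TransGrp {n : ℕ} {f : Equiv.Perm (Vec n)} (hf : f ∈ TransGrp n) :
    ∃ w, ∀ v, f v = v + w := by
  induction hf using Subgroup.closure_induction with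
  | mem x hx => exact hx
  | one => exact ⟨0, fun v => by simp⟩
  | mul x y _ _ hx hy =>
    obtain ⟨a, ha⟩ := hx
    obtain ⟨b, hb⟩ := hy
    exact ⟨b + a, fun v => by rw [Equiv.Perm.mul_apply, ha, hb, add_assoc]⟩
  | inv x _ hx =>
    obtain ⟨a, ha⟩ := hx
    exact ⟨-a, fun v => by rw [Equiv.Perm.inv_eq_iff_eq, ha, neg_add_cancel_right]⟩

/-- Every element of `Lgrp n` is a translation or a point reflection. -/
theorem exists_add_or_neg_add_of_mem_Lgrp {n : ℕ} {f : Equiv.Perm (Vec n)} (hf : f ∈ Lgrp n) :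
    (∃ w, ∀ v, f v = v + w) ∨ ∃ w, ∀ v, f v = -v + w := by
  induction hf using Subgroup.closure_induction with
  | mem x hx =>
    rcases hx with hx | rfl
    · exact Or.inl hx
    · exact Or.inr ⟨0, fun v => by simp⟩
  | one => exact Or.inl ⟨0, fun v => by simp⟩
  | mul x y _ _ hx hy =>
    rcases hx with ⟨a, ha⟩ | ⟨a, ha⟩ <;> rcases hy with ⟨b, hb⟩ | ⟨b, hb⟩
    · exact Or.inl ⟨b + a, fun v => by rw [Equiv.Perm.mul_apply, ha, hb]; abel⟩
    · exact Or.inr ⟨b + a, fun v => by rw [Equiv.Perm.mul_apply, ha, hb]; abel⟩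
    · exact Or.inr ⟨-b + a, fun v => by rw [Equiv.Perm.mul_apply, ha, hb]; abel⟩
    · exact Or.inl ⟨-b + a, fun v => by rw [Equiv.Perm.mul_apply, ha, hb]; abel⟩
  | inv x _ hx =>
    rcases hx with ⟨a, ha⟩ | ⟨a, ha⟩
    · exact Or.inl ⟨-a, fun v => by rw [Equiv.Perm.inv_eq_iff_eq, ha]; abel⟩
    · exact Or.inr ⟨a, fun v => by rw [Equiv.Perm.inv_eq_iff_eq, ha]; abel⟩

/-- Elements of `Lgrp n` centralize or invert each translation. -/
theorem mul_comm_or_mul_mul_eq_of_mem_TransGrp {n : ℕ} {t : ↥(Lgrp n)}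
    (ht : (t : Equiv.Perm (Vec n)) ∈ TransGrp n) (g : ↥(Lgrp n)) :
    t * g = g * t ∨ t * g * t = g := by
  obtain ⟨a, ha⟩ := exists_add_of_mem_TransGrp ht
  rcases exists_add_or_neg_add_of_mem_Lgrp g.2 with ⟨b, hb⟩ | ⟨b, hb⟩
  · refine Or.inl (Subtype.ext (Equiv.ext fun v => ?_))
    simp only [Subgroup.coe_mul, Equiv.Perm.mul_apply, ha, hb]
    abel
  · refine Or.inr (Subtype.ext (Equiv.ext fun v => ?_))
    simp only [Subgroup.coe_mul, Equiv.Perm.mul_apply, ha, hb]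
    abel

/-- if `W` is a nontrivial irreducible `𝔽₂L`-module and `t ∈ O₃(L)` (the
translation subgroup), then `t` acts trivially or fixed-point-freely on `W`. -/
theorem O3_element_trivial_or_fpf_on_module (n : ℕ) (hn : 2 ≤ n)
    (W : Type*) [AddCommGroup W] [Module (ZMod 2) W] [FiniteDimensional (ZMod 2) W]
    [DistribMulAction ↥(Lgrp n) W] [SMulCommClass ↥(Lgrp n) (ZMod 2) W]
    (hirr : ∀ U : Submodule (ZMod 2) W,
      (∀ (g : ↥(Lgrp n)) (w : W), w ∈ U → g • w ∈ U) → U = ⊥ ∨ U = ⊤)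
    (hnt : ∃ (g : ↥(Lgrp n)) (w : W), g • w ≠ w)
    (t : ↥(Lgrp n)) (ht : (t : Equiv.Perm (Vec n)) ∈ TransGrp n) :
    (∀ w : W, t • w = w) ∨ (∀ w : W, t • w = w → w = 0) := by
  let U : Submodule (ZMod 2) W :=
    { carrier := {w | t • w = w}
      add_mem' := fun {x y} (hx : t • x = x) (hy : t • y = y) =>
        show t • (x + y) = x + y by rw [smul_add, hx, hy]
      zero_mem' := smul_zero t
      smul_mem' := fun c x (hx : t • x = x) =>
        show t • c • x = c • x by rw [smul_comm, hx] }
  have hU : ∀ (g : ↥(Lgrp n)) (w : W), w ∈ U → g • w ∈ U := by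
    intro g w (hw : t • w = w)
    change t • g • w = g • w
    rcases mul_comm_or_mul_mul_eq_of_mem_TransGrp ht g with h | h
    · rw [smul_smul, h, mul_smul, hw]
    · calc t • g • w = (t * g * t) • w := by rw [mul_smul, mul_smul, hw]
        _ = g • w := by rw [h]
  rcases hirr U hU with h | h
  · exact Or.inr fun w hw => (Submodule.mem_bot (ZMod 2)).1 (h ▸ (show w ∈ U from hw))
  · exact Or.inl fun w => show w ∈ U from h ▸ Submodule.mem_top
end

section
/- For every vertex u of Γ (in particular for u = x): Z_u ≤ Ω₁(Z(Q_u)); in particular Z_u is an elementary abelian 2-group centralized by Q_u. -/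
open MulAction Pointwise

/-- The pointwise stabilizer `G_u^{[s]}` in `G` of the ball of radius `s` around `u`. -/
def ballStab {α : Type*} (Γ : SimpleGraph α) (G : Type*) [Group G] [MulAction G α]
    (u : α) (s : ℕ) : Subgroup G :=
  ⨅ w ∈ {w : α | Γ.dist u w ≤ s}, stabilizer G w

/-- `Z_{uw} = Ω₁(Z(G_u ∩ G_w))`, the subgroup generated by the elements of order at most 2
of the centre of the arc stabilizer `G_u ∩ G_w`. -/
def Zuw {α : Type*} (G : Type*) [Group G] [MulAction G α] (u w : α) : Subgroup G :=
  Subgroup.closure {g : G |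
    g ∈ (stabilizer G u ⊓ stabilizer G w) ⊓
        Subgroup.centralizer ((stabilizer G u ⊓ stabilizer G w : Subgroup G) : Set G) ∧ g ^ 2 = 1}

/-- `Z_u = ⟨Z_{uw}^{G_u}⟩`, the normal closure in `G_u` of the subgroups `Z_{uw}`,
for `w` a neighbour of `u` (independent of the choice of `w` by arc-transitivity). -/
def Zsub {α : Type*} (Γ : SimpleGraph α) (G : Type*) [Group G] [MulAction G α]
    (u : α) : Subgroup G :=
  Subgroup.closure {k : G | ∃ h ∈ stabilizer G u, ∃ w ∈ Γ.neighborSet u,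
    ∃ g ∈ Zuw G u w, k = h * g * h⁻¹}

/-- The critical distance `b = min { d(u,v) : Z_u ≰ G_v^{[1]} }`. -/
noncomputable def critDist {α : Type*} (Γ : SimpleGraph α) (G : Type*) [Group G]
    [MulAction G α] : ℕ :=
  sInf {d : ℕ | ∃ u v : α, Γ.dist u v = d ∧ ¬ Zsub Γ G u ≤ ballStab Γ G v 1}

/-- `(u,v)` is a critical pair: `d(u,v) = b` and `Z_u ≰ G_v^{[1]}`. -/
def critPair {α : Type*} (Γ : SimpleGraph α) (G : Type*) [Group G] [MulAction G α]
    (u v : α) : Prop :=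
  Γ.dist u v = critDist Γ G ∧ ¬ Zsub Γ G u ≤ ballStab Γ G v 1

/-- `(Γ, G)` is locally `L`: for each vertex `u` there is a bijection
`φ : Γ(u) ≃ V` conjugating the permutation group induced by `G_u` on `Γ(u)`
to exactly the permutation group `L` acting on `V`. -/
def LocallyL {α : Type*} (n : ℕ) (Γ : SimpleGraph α) (G : Type*) [Group G]
    [MulAction G α] : Prop :=
  ∀ u : α, ∃ φ : Γ.neighborSet u ≃ Vec n,
    (∀ g ∈ stabilizer G u, ∃ l ∈ Lgrp n, ∀ z : Γ.neighborSet u,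
      ∃ hz : (g • (z : α)) ∈ Γ.neighborSet u, φ ⟨g • (z : α), hz⟩ = l (φ z)) ∧
    (∀ l ∈ Lgrp n, ∃ g ∈ stabilizer G u, ∀ z : Γ.neighborSet u,
      ∃ hz : (g • (z : α)) ∈ Γ.neighborSet u, φ ⟨g • (z : α), hz⟩ = l (φ z))

theorem Lgrp_apply_eq {n : ℕ} {l : Equiv.Perm (Vec n)} (hl : l ∈ Lgrp n) :
    (∃ w, ∀ v, l v = v + w) ∨ ∃ w, ∀ v, l v = -v + w := by
  induction hl using Subgroup.closure_induction with
  | mem f hf =>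
    rcases hf with hf | rfl
    · exact Or.inl hf
    · exact Or.inr ⟨0, fun v => by simp⟩
  | one => exact Or.inl ⟨0, fun v => by simp⟩
  | mul f g _ _ hf hg =>
    rcases hf with ⟨a, ha⟩ | ⟨a, ha⟩ <;> rcases hg with ⟨b, hb⟩ | ⟨b, hb⟩
    · exact Or.inl ⟨b + a, fun v => by simp only [Equiv.Perm.mul_apply, ha, hb]; abel⟩
    · exact Or.inr ⟨b + a, fun v => by simp only [Equiv.Perm.mul_apply, ha, hb]; abel⟩
    · exact Or.inr ⟨-b + a, fun v => by simp only [Equiv.Perm.mul_apply, ha, hb]; abel⟩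
    · exact Or.inl ⟨-b + a, fun v => by simp only [Equiv.Perm.mul_apply, ha, hb]; abel⟩
  | inv f _ hf =>
    rcases hf with ⟨a, ha⟩ | ⟨a, ha⟩
    · exact Or.inl ⟨-a, fun v => by rw [Equiv.Perm.inv_eq_iff_eq, ha]; abel⟩
    · exact Or.inr ⟨a, fun v => by rw [Equiv.Perm.inv_eq_iff_eq, ha]; abel⟩

/-- A non-identity element of `L` fixing `a` is the point reflection in `a`. -/
theorem Lgrp_apply_of_fixed {n : ℕ} {l : Equiv.Perm (Vec n)} (hl : l ∈ Lgrp n) {a : Vec n}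
    (ha : l a = a) : (∀ v, l v = v) ∨ ∀ v, l v = -v + (a + a) := by
  rcases Lgrp_apply_eq hl with ⟨w, hw⟩ | ⟨w, hw⟩
  · left
    have h0 : w = 0 := by simpa [hw] using ha
    simpa [h0] using hw
  · right
    have h0 : w = a + a := by
      rw [hw] at ha
      exact neg_add_eq_iff_eq_add.mp ha
    simpa [h0] using hw

theorem translation_mem_Lgrp {n : ℕ} (w : Vec n) : Equiv.addRight w ∈ Lgrp n :=
  Subgroup.subset_closure (Or.inl ⟨w, fun _ => rfl⟩)

section

variable {α : Type*} {Γ : SimpleGraph α} {G : Type*} [Group G] [MulAction G α]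

theorem mem_ballStab_one (hconn : Γ.Connected) {u : α} {g : G} :
    g ∈ ballStab Γ G u 1 ↔ g • u = u ∧ ∀ w, Γ.Adj u w → g • w = w := by
  simp only [ballStab, Subgroup.mem_iInf, Set.mem_ofPred_eq, mem_stabilizer_iff]
  constructor
  · intro h
    exact ⟨h u (by simp), fun w hw => h w (SimpleGraph.dist_eq_one_iff_adj.mpr hw).le⟩
  · rintro ⟨hu, h⟩ w hw
    rcases Nat.le_one_iff_eq_zero_or_eq_one.mp hw with h0 | h1
    · rwa [← hconn.dist_eq_zero_iff.mp h0]
    · exact h w (SimpleGraph.dist_eq_one_iff_adj.mp h1)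

theorem conj_mem_ballStab_one (hconn : Γ.Connected)
    (haut : ∀ (g : G) (u w : α), Γ.Adj u w ↔ Γ.Adj (g • u) (g • w))
    {u : α} {g : G} (hg : g ∈ ballStab Γ G u 1) (h : G) :
    h * g * h⁻¹ ∈ ballStab Γ G (h • u) 1 := by
  rw [mem_ballStab_one hconn] at hg ⊢
  refine ⟨by simp [mul_smul, hg.1], fun w hw => ?_⟩
  have hw' : Γ.Adj u (h⁻¹ • w) := by simpa using (haut h⁻¹ _ _).mp hw
  simp [mul_smul, hg.2 _ hw']

/-- If `z` centralizes the arc stabilizer `G_{uw}` but does not fix `Γ(u)` pointwise, then the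
centralizer of `Q_u` in `G_u` is transitive on `Γ(u)`. -/
theorem exists_centralizing_smul_eq {n : ℕ} (hconn : Γ.Connected)
    (haut : ∀ (g : G) (u w : α), Γ.Adj u w ↔ Γ.Adj (g • u) (g • w))
    (hloc : LocallyL n Γ G) {u w : α} (huw : Γ.Adj u w) {z : G}
    (hzu : z • u = u) (hzw : z • w = w)
    (hz : ∀ q ∈ stabilizer G u ⊓ stabilizer G w, q * z = z * q)
    (hzQ : z ∉ ballStab Γ G u 1) {w' : α} (hw' : Γ.Adj u w') :
    ∃ c : G, c • u = u ∧ c • w = w' ∧ ∀ q ∈ ballStab Γ G u 1, q * c = c * q := by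
  obtain ⟨φ, hφ, hφ'⟩ := hloc u
  obtain ⟨l, hl, hzl⟩ := hφ z hzu
  have hfix : l (φ ⟨w, huw⟩) = φ ⟨w, huw⟩ := by
    obtain ⟨h1, h2⟩ := hzl ⟨w, huw⟩
    rw [← h2]
    congr 2
  have hl' : ∀ v, l v = -v + (φ ⟨w, huw⟩ + φ ⟨w, huw⟩) := by
    refine (Lgrp_apply_of_fixed hl hfix).resolve_left fun hid => hzQ ?_
    rw [mem_ballStab_one hconn]
    refine ⟨hzu, fun t ht => ?_⟩
    obtain ⟨h1, h2⟩ := hzl ⟨t, ht⟩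
    rw [hid] at h2
    exact congrArg Subtype.val (φ.injective h2)
  set a := φ ⟨w, huw⟩ with ha
  set b := φ ⟨w', hw'⟩ with hb
  -- `a + (a - b)` is the midpoint of `a` and `b` in characteristic 3
  obtain ⟨h, hhu, hh⟩ := hφ' _ (translation_mem_Lgrp (a - b))
  have hh' : h⁻¹ • u = u := inv_smul_eq_iff.mpr (Eq.symm hhu)
  have key : z • h⁻¹ • w = h⁻¹ • w' := by
    have hadj : ∀ t, Γ.Adj u t → Γ.Adj u (h⁻¹ • t) := fun t ht => by
      simpa [hh'] using (haut h⁻¹ _ _).mp ht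
    have hinv : ∀ t (ht : Γ.Adj u t), φ ⟨h⁻¹ • t, hadj t ht⟩ = φ ⟨t, ht⟩ - (a - b) := by
      intro t ht
      obtain ⟨h1, h2⟩ := hh ⟨h⁻¹ • t, hadj t ht⟩
      simp only [smul_inv_smul, Equiv.coe_addRight] at h2
      rw [h2, add_sub_cancel_right]
    obtain ⟨h1, h2⟩ := hzl ⟨h⁻¹ • w, hadj w huw⟩
    have h3 : φ ⟨z • h⁻¹ • w, h1⟩ = φ ⟨h⁻¹ • w', hadj w' hw'⟩ := by
      rw [h2, hinv w huw, hinv w' hw', hl', ← ha, ← hb]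
      funext i
      simp only [Pi.add_apply, Pi.sub_apply, Pi.neg_apply]
      generalize a i = p
      generalize b i = q
      revert p q
      decide
    exact congrArg Subtype.val (φ.injective h3)
  refine ⟨h * z * h⁻¹, ?_, ?_, fun q hq => ?_⟩
  · rw [mul_smul, mul_smul, hh', hzu]
    exact hhu
  · rw [mul_smul, mul_smul, key, smul_inv_smul]
  · have hq' := conj_mem_ballStab_one hconn haut hq h⁻¹
    rw [hh', inv_inv, mem_ballStab_one hconn] at hq'
    have := hz _ ⟨hq'.1, hq'.2 w huw⟩
    calc q * (h * z * h⁻¹) = h * (h⁻¹ * q * h * z) * h⁻¹ := by group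
      _ = h * z * h⁻¹ * q := by rw [this]; group

theorem ballStab_inf_eq_bot_of_transitive (hconn : Γ.Connected)
    (haut : ∀ (g : G) (u w : α), Γ.Adj u w ↔ Γ.Adj (g • u) (g • w))
    (hfaith : ∀ g : G, (∀ u : α, g • u = u) → g = 1)
    (htrans : ∀ u w w' : α, Γ.Adj u w → Γ.Adj u w' →
      ∃ c : G, c • u = u ∧ c • w = w' ∧ ∀ q ∈ ballStab Γ G u 1, q * c = c * q)
    {x y : α} (hxy : Γ.Adj x y) : ballStab Γ G x 1 ⊓ ballStab Γ G y 1 = ⊥ := by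
  rw [eq_bot_iff]
  rintro k ⟨hkx, hky⟩
  have step : ∀ u w w' : α, Γ.Adj u w → Γ.Adj u w' → k ∈ ballStab Γ G u 1 →
      k ∈ ballStab Γ G w 1 → k ∈ ballStab Γ G w' 1 := by
    intro u w w' hw hw' hu hkw
    obtain ⟨c, -, hcw, hc⟩ := htrans u w w' hw hw'
    have := conj_mem_ballStab_one hconn haut hkw c
    rwa [hcw, ← hc k hu, mul_inv_cancel_right] at this
  have hall : ∀ v, k ∈ ballStab Γ G v 1 ∧ ∀ w, Γ.Adj v w → k ∈ ballStab Γ G w 1 := by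
    intro v
    induction (SimpleGraph.reachable_iff_reflTransGen x v).mp (hconn x v) with
    | refl => exact ⟨hkx, fun w hw => step x y w hxy hw hkx hky⟩
    | tail _ h ih =>
      exact ⟨ih.2 _ h, fun w hw => step _ _ w h.symm hw (ih.2 _ h) ih.1⟩
  exact Subgroup.mem_bot.mpr (hfaith k fun v => ((mem_ballStab_one hconn).mp (hall v).1).1)

theorem mem_ballStab_of_centralizes_arc_stabilizer {n : ℕ} (hconn : Γ.Connected)
    (haut : ∀ (g : G) (u w : α), Γ.Adj u w ↔ Γ.Adj (g • u) (g • w))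
    (hfaith : ∀ g : G, (∀ u : α, g • u = u) → g = 1)
    (harc : ∀ u w u' w' : α, Γ.Adj u w → Γ.Adj u' w' → ∃ g : G, g • u = u' ∧ g • w = w')
    (hloc : LocallyL n Γ G) {x y : α} (hxy : Γ.Adj x y)
    (hntriv : ballStab Γ G x 1 ⊓ ballStab Γ G y 1 ≠ ⊥)
    {u w : α} (huw : Γ.Adj u w) {z : G} (hzu : z • u = u) (hzw : z • w = w)
    (hz : ∀ q ∈ stabilizer G u ⊓ stabilizer G w, q * z = z * q) :
    z ∈ ballStab Γ G u 1 := by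
  by_contra hzQ
  refine hntriv (ballStab_inf_eq_bot_of_transitive hconn haut hfaith ?_ hxy)
  intro u' w' w'' hw' hw''
  obtain ⟨g, rfl, rfl⟩ := harc u w u' w' huw hw'
  refine exists_centralizing_smul_eq hconn haut hloc hw' (z := g * z * g⁻¹) ?_ ?_ ?_ ?_ hw''
  · simp [mul_smul, hzu]
  · simp [mul_smul, hzw]
  · rintro q ⟨hq1, hq2⟩
    have hq1' : q • g • u = g • u := hq1
    have hq2' : q • g • w = g • w := hq2
    have := hz (g⁻¹ * q * g) ⟨by simp [mul_smul, hq1'], by simp [mul_smul, hq2']⟩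
    calc q * (g * z * g⁻¹) = g * (g⁻¹ * q * g * z) * g⁻¹ := by group
      _ = g * z * g⁻¹ * q := by rw [this]; group
  · intro hmem
    have := conj_mem_ballStab_one hconn haut hmem g⁻¹
    exact hzQ (by simpa [mul_assoc] using this)

end

/-- The elements of order at most 2 in the centre of a subgroup. -/
def omegaOneCenter {G : Type*} [Group G] (Q : Subgroup G) : Subgroup G where
  carrier := {g | g ∈ Q ⊓ Subgroup.centralizer (Q : Set G) ∧ g ^ 2 = 1}
  one_mem' := ⟨one_mem _, one_pow 2⟩
  mul_mem' := by
    rintro a b ⟨ha, ha2⟩ ⟨hb, hb2⟩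
    have hc : Commute a b := Subgroup.mem_centralizer_iff.mp hb.2 a ha.1
    exact ⟨mul_mem ha hb, by rw [hc.mul_pow, ha2, hb2, one_mul]⟩
  inv_mem' := by
    rintro a ⟨ha, ha2⟩
    exact ⟨inv_mem ha, by rw [inv_pow, ha2, inv_one]⟩

/-- for every vertex `u`, `Z_u ≤ Ω₁(Z(Q_u))`; in particular `Z_u` is an
elementary abelian 2-group centralized by `Q_u`. -/
theorem Zsub_le_omega1_center_Q
    {α : Type*} (n : ℕ) (hn : 2 ≤ n) (Γ : SimpleGraph α)
    (G : Type*) [Group G] [MulAction G α]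
    (hconn : Γ.Connected) (hacyc : Γ.IsAcyclic)
    (haut : ∀ (g : G) (u w : α), Γ.Adj u w ↔ Γ.Adj (g • u) (g • w))
    (hfaith : ∀ g : G, (∀ u : α, g • u = u) → g = 1)
    (harc : ∀ u w u' w' : α, Γ.Adj u w → Γ.Adj u' w' → ∃ g : G, g • u = u' ∧ g • w = w')
    (hfin : ∀ u : α, Finite (stabilizer G u))
    (hloc : LocallyL n Γ G)
    (x y : α) (hxy : Γ.Adj x y)
    (hntriv : ballStab Γ G x 1 ⊓ ballStab Γ G y 1 ≠ ⊥)
 :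
    ∀ u : α,
      Zsub Γ G u ≤ Subgroup.closure {g : G |
        g ∈ ballStab Γ G u 1 ⊓
          Subgroup.centralizer ((ballStab Γ G u 1 : Subgroup G) : Set G) ∧ g ^ 2 = 1} ∧
      (∀ g ∈ Zsub Γ G u, g ^ 2 = 1) ∧
      (∀ g ∈ Zsub Γ G u, ∀ h ∈ Zsub Γ G u, g * h = h * g) ∧
      (∀ g ∈ Zsub Γ G u, ∀ q ∈ ballStab Γ G u 1, q * g = g * q) := by
  intro u
  have hle : Zsub Γ G u ≤ omegaOneCenter (ballStab Γ G u 1) := by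
    refine (Subgroup.closure_le _).mpr ?_
    rintro _ ⟨h, hh, w, hw, g, hg, rfl⟩
    have hg' : g ∈ omegaOneCenter (ballStab Γ G u 1) := by
      refine (Subgroup.closure_le _).mpr ?_ hg
      rintro z ⟨⟨⟨hzu, hzw⟩, hz⟩, hz2⟩
      have hz' := Subgroup.mem_centralizer_iff.mp hz
      refine ⟨⟨mem_ballStab_of_centralizes_arc_stabilizer hconn haut hfaith harc hloc hxy hntriv
        hw hzu hzw hz', Subgroup.mem_centralizer_iff.mpr fun q hq => ?_⟩, hz2⟩
      have hq' := (mem_ballStab_one hconn).mp hq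
      exact hz' q ⟨hq'.1, hq'.2 w hw⟩
    obtain ⟨⟨hgQ, hgC⟩, hg2⟩ := hg'
    have hhu : h • u = u := hh
    have hhu' : h⁻¹ • u = u := inv_smul_eq_iff.mpr hhu.symm
    refine ⟨⟨?_, Subgroup.mem_centralizer_iff.mpr fun q hq => ?_⟩, ?_⟩
    · simpa [hhu] using conj_mem_ballStab_one hconn haut hgQ h
    · have hq' := conj_mem_ballStab_one hconn haut hq h⁻¹
      rw [hhu', inv_inv] at hq'
      have := Subgroup.mem_centralizer_iff.mp hgC _ hq'
      calc q * (h * g * h⁻¹) = h * (h⁻¹ * q * h * g) * h⁻¹ := by group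
        _ = h * g * h⁻¹ * q := by rw [this]; group
    · rw [conj_pow, hg2, mul_one, mul_inv_cancel]
  have hcomm : ∀ g ∈ Zsub Γ G u, ∀ q ∈ ballStab Γ G u 1, q * g = g * q :=
    fun g hg q hq => Subgroup.mem_centralizer_iff.mp (hle hg).1.2 q hq
  exact ⟨fun g hg => Subgroup.subset_closure (hle hg), fun g hg => (hle hg).2,
    fun g hg h hh => hcomm h hh g (hle hg).1.1, hcomm⟩
end
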